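/- arXiv:0904.0855 — 6 statements merged into one kernel-verified Lean document; each statement's English description precedes it below -/
import Mathlib

section
/- For every real z with |z| < 2, one has (2·arsinh(z/2))² = Σ_{n=1}^{∞} 2(−1)^{n+1} z^{2n} / (n² · binom(2n, n)), the series converging absolutely. -/
open Real Filter

/-- The `n`-th coefficient `2(−1)^{n+1} z^{2n} / (n² · binom(2n, n))` of the
series for `(2·arsinh(z/2))²`. -/
noncomputable def arsinhSqTerm (z : ℝ) (n : ℕ) : ℝ :=
  2 * (-1 : ℝ)^(n + 1) * z^(2 * n) / ((n : ℝ)^2 * (Nat.choose (2 * n) n : ℝ))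

namespace ArsinhSq

noncomputable def h (n : ℕ) (x : ℝ) : ℝ := 2 * (-1 : ℝ)^n * x^(2*n) / (Nat.centralBinom n : ℝ)
noncomputable def g (n : ℕ) (x : ℝ) : ℝ :=
  2 * (-1 : ℝ)^n * x^(2*n+1) / ((2*n+1) * (Nat.centralBinom n : ℝ))
noncomputable def f (n : ℕ) (x : ℝ) : ℝ :=
  2 * (-1 : ℝ)^n * x^(2*n+2) / ((2*n+1) * (2*n+2) * (Nat.centralBinom n : ℝ))

lemma cpos (n : ℕ) : (0:ℝ) < Nat.centralBinom n := by exact_mod_cast Nat.centralBinom_pos n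

lemma csucc (n : ℕ) : ((n:ℝ)+1) * Nat.centralBinom (n+1) = 2*(2*n+1) * Nat.centralBinom n := by
  exact_mod_cast Nat.succ_mul_centralBinom_succ n

lemma csucc' (n : ℕ) :
    (Nat.centralBinom (n+1) : ℝ) = 2*(2*n+1) * Nat.centralBinom n / ((n:ℝ)+1) := by
  rw [← csucc]; field_simp

lemma cbound (n : ℕ) : (4:ℝ)^n ≤ (2*n+1) * Nat.centralBinom n := by
  have : 4^n ≤ (2*n+1) * Nat.centralBinom n := by
    rcases Nat.eq_zero_or_pos n with rfl | hn
    · simp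
    · have := Nat.four_pow_le_two_mul_self_mul_centralBinom n hn
      nlinarith
  exact_mod_cast this

lemma term_eq (z : ℝ) (n : ℕ) : arsinhSqTerm z (n+1) = f n z := by
  have hc := cpos n
  unfold arsinhSqTerm f
  rw [← Nat.centralBinom_eq_two_mul_choose, csucc', show 2*(n+1) = 2*n+2 by ring]
  push_cast
  field_simp
  ring

noncomputable def u (r : ℝ) (n : ℕ) : ℝ := 2*(2*n+1) * (r^2/4)^n

lemma u_summable {r : ℝ} (h0 : 0 ≤ r) (h2 : r < 2) : Summable (u r) := by
  have hq : ‖r^2/4‖ < 1 := by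
    rw [Real.norm_of_nonneg (by positivity)]; nlinarith
  have h1 := (summable_pow_mul_geometric_of_norm_lt_one 1 hq).mul_left 4
  have h3 := (summable_geometric_of_norm_lt_one hq).mul_left 2
  refine (h1.add h3).congr fun n => ?_
  unfold u; ring

lemma h_bound {r x : ℝ} (hx : |x| ≤ r) (n : ℕ) : ‖h n x‖ ≤ u r n := by
  have hc := cpos n
  have hb := cbound n
  have h1 : ‖h n x‖ = 2 * (x^2)^n / Nat.centralBinom n := by
    unfold h
    rw [norm_div, norm_mul, norm_mul, norm_pow, norm_pow, pow_mul]
    simp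
  have h2 : x^2 ≤ r^2 := by rw [← sq_abs]; gcongr
  have h3 : (x^2)^n ≤ (r^2)^n := by gcongr
  rw [h1, u, div_pow, div_le_iff₀ hc]
  have h4 : (1:ℝ) ≤ (2*n+1) * Nat.centralBinom n / 4^n := by
    rw [le_div_iff₀ (by positivity)]; linarith
  have h5 : 0 ≤ (r^2)^n := by positivity
  calc 2 * (x^2)^n ≤ 2 * (r^2)^n * 1 := by linarith
    _ ≤ 2 * (r^2)^n * ((2*n+1) * Nat.centralBinom n / 4^n) := by gcongr
    _ = _ := by ring

lemma g_eq (n : ℕ) (x : ℝ) : g n x = h n x * (x / (2*n+1)) := by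
  have hc := cpos n
  unfold g h; field_simp; ring

lemma f_eq (n : ℕ) (x : ℝ) : f n x = g n x * (x / (2*n+2)) := by
  have hc := cpos n
  unfold g f; field_simp; ring

lemma aux {x d : ℝ} (hx : |x| ≤ 2) (hd : 1 ≤ d) : ‖x / d‖ ≤ 2 := by
  rw [norm_div, Real.norm_eq_abs, Real.norm_of_nonneg (by linarith),
    div_le_iff₀ (by linarith)]
  linarith

lemma g_bound {r x : ℝ} (hx : |x| ≤ r) (hr : r < 2) (n : ℕ) : ‖g n x‖ ≤ u r n * 2 := by
  rw [g_eq, norm_mul]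
  have := h_bound hx n
  have h0 : 0 ≤ u r n := (norm_nonneg _).trans this
  have hn : (0:ℝ) ≤ n := n.cast_nonneg
  exact mul_le_mul this (aux (by linarith) (by linarith)) (norm_nonneg _) h0

lemma f_bound {r x : ℝ} (hx : |x| ≤ r) (hr : r < 2) (n : ℕ) : ‖f n x‖ ≤ u r n * 2 * 2 := by
  rw [f_eq, norm_mul]
  have := g_bound hx hr n
  have h0 : 0 ≤ u r n * 2 := (norm_nonneg _).trans this
  have hn : (0:ℝ) ≤ n := n.cast_nonneg
  exact mul_le_mul this (aux (by linarith) (by linarith)) (norm_nonneg _) h0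

lemma g_deriv (n : ℕ) (x : ℝ) : HasDerivAt (g n) (h n x) x := by
  have hc := cpos n
  have := ((hasDerivAt_pow (2*n+1) x).const_mul (2 * (-1 : ℝ)^n)).div_const
    ((2*n+1) * (Nat.centralBinom n : ℝ))
  refine this.congr_deriv ?_
  unfold h; push_cast
  field_simp

lemma f_deriv (n : ℕ) (x : ℝ) : HasDerivAt (f n) (g n x) x := by
  have hc := cpos n
  have := ((hasDerivAt_pow (2*n+2) x).const_mul (2 * (-1 : ℝ)^n)).div_const
    ((2*n+1) * (2*n+2) * (Nat.centralBinom n : ℝ))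
  refine this.congr_deriv ?_
  unfold g; push_cast
  field_simp

lemma h_sum {x : ℝ} (hx : |x| < 2) : Summable (fun n => h n x) :=
  Summable.of_norm_bounded (u_summable (abs_nonneg x) hx) (h_bound le_rfl)
lemma g_sum {x : ℝ} (hx : |x| < 2) : Summable (fun n => g n x) :=
  Summable.of_norm_bounded ((u_summable (abs_nonneg x) hx).mul_right 2) (g_bound le_rfl hx)
lemma f_sum_norm {x : ℝ} (hx : |x| < 2) : Summable (fun n => ‖f n x‖) :=
  Summable.of_nonneg_of_le (fun _ => norm_nonneg _) (f_bound le_rfl hx)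
    (((u_summable (abs_nonneg x) hx).mul_right 2).mul_right 2)

lemma G_deriv {x : ℝ} (hx : |x| < 2) :
    HasDerivAt (fun y => ∑' n, g n y) (∑' n, h n x) x := by
  obtain ⟨r, h1, h2⟩ := exists_between hx
  have hm : x ∈ Set.Ioo (-r) r := abs_lt.1 h1
  exact hasDerivAt_tsum_of_isPreconnected
    (u_summable ((abs_nonneg x).trans h1.le) h2) isOpen_Ioo isPreconnected_Ioo
    (fun n y _ => g_deriv n y) (fun n y hy => h_bound (abs_lt.2 hy).le n) hm (g_sum hx) hm

lemma F_deriv {x : ℝ} (hx : |x| < 2) :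
    HasDerivAt (fun y => ∑' n, f n y) (∑' n, g n x) x := by
  obtain ⟨r, h1, h2⟩ := exists_between hx
  have hm : x ∈ Set.Ioo (-r) r := abs_lt.1 h1
  exact hasDerivAt_tsum_of_isPreconnected
    ((u_summable ((abs_nonneg x).trans h1.le) h2).mul_right 2) isOpen_Ioo isPreconnected_Ioo
    (fun n y _ => f_deriv n y) (fun n y hy => g_bound (abs_lt.2 hy).le h2 n) hm
    (f_sum_norm hx).of_norm hm

lemma ode {x : ℝ} (hx : |x| < 2) :
    (4 + x^2) * (∑' n, h n x) + x * (∑' n, g n x) = 8 := by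
  have hh := h_sum hx
  have e1 := hh.tsum_eq_zero_add
  have hh1 := (summable_nat_add_iff 1).2 hh
  have key : ∀ n, 4 * h (n+1) x + x^2 * h n x + x * g n x = 0 := by
    intro n
    have hc := cpos n
    unfold h g
    rw [csucc']
    field_simp
    ring
  have s : ∑' n, (4 * h (n+1) x + x^2 * h n x + x * g n x) = 0 := by simp [key]
  rw [((hh1.mul_left 4).add (hh.mul_left _)).tsum_add ((g_sum hx).mul_left _),
    (hh1.mul_left 4).tsum_add (hh.mul_left _), tsum_mul_left, tsum_mul_left, tsum_mul_left] at s
  have h0 : h 0 x = 2 := by simp [h]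
  rw [h0] at e1
  linarith

lemma const {k : ℝ → ℝ} (h0 : k 0 = 0) (hk : ∀ x, |x| < 2 → HasDerivAt k 0 x) {x : ℝ}
    (hx : |x| < 2) : k x = 0 := by
  have := (isOpen_Ioo (a := (-2:ℝ)) (b := 2)).is_const_of_deriv_eq_zero isPreconnected_Ioo
    (f := k) (fun y hy => (hk y (abs_lt.2 hy)).differentiableAt.differentiableWithinAt)
    (fun y hy => (hk y (abs_lt.2 hy)).deriv) (abs_lt.1 hx) (show (0:ℝ) ∈ _ by simp)
  rw [this, h0]

lemma ars_deriv (x : ℝ) : HasDerivAt (fun y => arsinh (y/2)) (√(4+x^2))⁻¹ x := by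
  have := ((hasDerivAt_id x).div_const 2).arsinh
  refine this.congr_deriv ?_
  have e : √(4+x^2) = 2 * √(1+(x/2)^2) := by
    rw [show 4 + x^2 = 2^2 * (1+(x/2)^2) by ring, Real.sqrt_mul (by norm_num),
      Real.sqrt_sq (by norm_num)]
  have hp : 0 < √(1+(x/2)^2) := by positivity
  rw [e]
  simp only [id, smul_eq_mul]
  field_simp

lemma G_eq {x : ℝ} (hx : |x| < 2) : √(4+x^2) * (∑' n, g n x) = 8 * arsinh (x/2) := by
  have := const (k := fun x => √(4+x^2) * (∑' n, g n x) - 8 * arsinh (x/2))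
    (by simp [g]) (fun x hx => by
      have hp : 0 < √(4+x^2) := by positivity
      have hs : √(4+x^2)^2 = 4+x^2 := Real.sq_sqrt (by positivity)
      have d1 : HasDerivAt (fun y : ℝ => √(4+y^2)) (x / √(4+x^2)) x := by
        have := ((hasDerivAt_pow 2 x).const_add 4).sqrt (by positivity)
        refine this.congr_deriv ?_
        push_cast; field_simp
      refine ((d1.mul (G_deriv hx)).sub ((ars_deriv x).const_mul 8)).congr_deriv ?_
      have := ode hx
      field_simp
      rw [hs]
      linarith) hx
  linarith

lemma F_eq {x : ℝ} (hx : |x| < 2) : (∑' n, f n x) = (2 * arsinh (x/2))^2 := by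
  have := const (k := fun x => (∑' n, f n x) - (2 * arsinh (x/2))^2)
    (by simp [f]) (fun x hx => by
      have hp : 0 < √(4+x^2) := by positivity
      refine ((F_deriv hx).sub (((ars_deriv x).const_mul 2).pow 2)).congr_deriv ?_
      have := G_eq hx
      field_simp
      push_cast
      linarith) hx
  linarith

end ArsinhSq

theorem arsinh_sq_series (z : ℝ) (hz : |z| < 2) :
    HasSum (fun n : ℕ => arsinhSqTerm z (n + 1)) ((2 * Real.arsinh (z / 2))^2) ∧
    Summable (fun n : ℕ => |arsinhSqTerm z (n + 1)|) := by
  simp only [ArsinhSq.term_eq]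
  refine ⟨?_, ArsinhSq.f_sum_norm hz⟩
  rw [← ArsinhSq.F_eq hz]
  exact (ArsinhSq.f_sum_norm hz).of_norm.hasSum
end

section
/- Let u : ℝ² → ℝ be of class C⁴ and fix (x,y) ∈ ℝ². Then the subgrid nonlinear stencil combination satisfies (1/12)(δ²(u³))(x,y) − (1/4) u(x,y)² (δ² u)(x,y) = (h²/2) u(x,y) [ (∂u/∂x)(x,y)² + (∂u/∂y)(x,y)² ] + O(h⁴) as h → 0, where δ²(u³) denotes the five-point stencil applied to the function (x,y) ↦ u(x,y)³. -/
open Real Filter Asymptotics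

/-- Centred difference in `x` with spacing `h`, for a function of two variables. -/
noncomputable def cdiffX (h : ℝ) (u : ℝ → ℝ → ℝ) : ℝ → ℝ → ℝ :=
  fun x y => u (x + h) y - 2 * u x y + u (x - h) y

/-- Centred difference in `y` with spacing `h`, for a function of two variables. -/
noncomputable def cdiffY (h : ℝ) (u : ℝ → ℝ → ℝ) : ℝ → ℝ → ℝ :=
  fun x y => u x (y + h) - 2 * u x y + u x (y - h)

/-- The five-point stencil `δ² = δ_x² + δ_y²`. -/
noncomputable def stencil2 (h : ℝ) (u : ℝ → ℝ → ℝ) : ℝ → ℝ → ℝ :=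
  fun x y => cdiffX h u x y + cdiffY h u x y

/-- The stencil `δ⁴ = δ_x⁴ + δ_y⁴`. -/
noncomputable def stencil4 (h : ℝ) (u : ℝ → ℝ → ℝ) : ℝ → ℝ → ℝ :=
  fun x y => (cdiffX h)^[2] u x y + (cdiffY h)^[2] u x y

/-- The stencil `δ⁶ = δ_x⁶ + δ_y⁶`. -/
noncomputable def stencil6 (h : ℝ) (u : ℝ → ℝ → ℝ) : ℝ → ℝ → ℝ :=
  fun x y => (cdiffX h)^[3] u x y + (cdiffY h)^[3] u x y

/-- Second-order Taylor expansion with a cubic remainder. -/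
lemma taylor_cubic_remainder (g : ℝ → ℝ) (hg : ContDiff ℝ 4 g) (t : ℝ) :
    ∃ a : ℝ, (fun h : ℝ => g (t + h) - g t - deriv g t * h - a * h ^ 2)
      =O[nhds (0:ℝ)] (fun h : ℝ => h ^ 3) := by
  have h3 : ContDiff ℝ (3 : ℕ) g := hg.of_le (by norm_num)
  have key := (taylor_isLittleO_univ (x₀ := t) h3).isBigO
  have ht : Tendsto (fun h : ℝ => t + h) (nhds 0) (nhds t) := by
    have : Continuous (fun h : ℝ => t + h) := by fun_prop
    simpa using this.tendsto 0
  have key2 := key.comp_tendsto ht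
  refine ⟨iteratedDeriv 2 g t / 2, ?_⟩
  have hb : (fun h : ℝ => (iteratedDeriv 3 g t / 6) * h ^ 3)
      =O[nhds (0:ℝ)] (fun h : ℝ => h ^ 3) :=
    (isBigO_refl _ _).const_mul_left _
  have key3 : (fun h : ℝ => g (t + h) - taylorWithinEval g 3 Set.univ t (t + h))
      =O[nhds (0:ℝ)] (fun h : ℝ => h ^ 3) := by
    simpa [Function.comp_def] using key2
  refine (key3.add hb).congr_left ?_
  intro h
  simp only [taylorWithinEval_succ, taylor_within_zero_eval, iteratedDerivWithin_univ, smul_eq_mul,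
    zero_add, iteratedDeriv_one, Nat.factorial]
  push_cast
  ring

/-- The one-dimensional version of the identity. -/
lemma stencil_one_dim (g : ℝ → ℝ) (hg : ContDiff ℝ 4 g) (t : ℝ) :
    (fun h : ℝ =>
        ((1 / 12) * (g (t + h) ^ 3 - 2 * g t ^ 3 + g (t - h) ^ 3)
          - (1 / 4) * g t ^ 2 * (g (t + h) - 2 * g t + g (t - h)))
        - (h^2 / 2) * g t * (deriv g t)^2)
      =O[nhds (0:ℝ)] (fun h : ℝ => h^4) := by
  obtain ⟨a, hR⟩ := taylor_cubic_remainder g hg t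
  set p := g t
  set d := deriv g t
  have hneg : Tendsto (fun h : ℝ => -h) (nhds 0) (nhds 0) := by
    simpa using (continuous_neg (G := ℝ)).tendsto 0
  have hS : (fun h : ℝ => g (t - h) - p + d * h - a * h ^ 2)
      =O[nhds (0:ℝ)] (fun h : ℝ => h ^ 3) := by
    have := (hR.comp_tendsto hneg).neg_right
    refine this.congr ?_ ?_
    · intro h
      simp only [Function.comp_def, ← sub_eq_add_neg]
      ring
    · intro h
      simp only [Function.comp_def]
      ring
  have hpow : ∀ m n : ℕ, n ≤ m →
      (fun h : ℝ => h ^ m) =O[nhds (0:ℝ)] (fun h : ℝ => h ^ n) := fun m n hmn =>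
    by
    obtain ⟨k, rfl⟩ := Nat.exists_eq_add_of_le hmn
    have hk : (fun h : ℝ => h ^ k) =O[nhds (0:ℝ)] (fun _ : ℝ => (1:ℝ)) :=
      ((continuous_pow k).tendsto (0:ℝ)).isBigO_one ℝ
    exact ((isBigO_refl (fun h : ℝ => h ^ n) _).mul hk).congr (fun h => by ring) (fun h => by ring)
  have hα : (fun h : ℝ => g (t + h) - p - d * h) =O[nhds (0:ℝ)] (fun h : ℝ => h ^ 2) :=
    ((hR.trans (hpow 3 2 (by norm_num))).add
      ((isBigO_refl (fun h : ℝ => h ^ 2) _).const_mul_left a)).congr_left (fun h => by ring)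
  have hβ : (fun h : ℝ => g (t - h) - p + d * h) =O[nhds (0:ℝ)] (fun h : ℝ => h ^ 2) :=
    ((hS.trans (hpow 3 2 (by norm_num))).add
      ((isBigO_refl (fun h : ℝ => h ^ 2) _).const_mul_left a)).congr_left (fun h => by ring)
  have hid : (fun h : ℝ => d * h) =O[nhds (0:ℝ)] (fun h : ℝ => h ^ 1) :=
    ((isBigO_refl (fun h : ℝ => h ^ 1) _).const_mul_left d).congr_left (fun h => by ring)
  have hA : (fun h : ℝ => g (t + h) - p) =O[nhds (0:ℝ)] (fun h : ℝ => h ^ 1) :=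
    ((hα.trans (hpow 2 1 (by norm_num))).add hid).congr_left (fun h => by ring)
  have hB : (fun h : ℝ => g (t - h) - p) =O[nhds (0:ℝ)] (fun h : ℝ => h ^ 1) :=
    ((hβ.trans (hpow 2 1 (by norm_num))).sub hid).congr_left (fun h => by ring)
  have e1 := ((hid.mul (hR.sub hS)).const_mul_left (p / 2)).congr_right
    (g₂ := fun h : ℝ => h ^ 4) (fun h => by ring)
  have e2 := (((hα.mul hα).add (hβ.mul hβ)).const_mul_left (p / 4)).congr_right
    (g₂ := fun h : ℝ => h ^ 4) (fun h => by ring)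
  have e3 := (((hα.add hβ).mul (((hA.mul hA).sub (hA.mul hB)).add (hB.mul hB))).const_mul_left
    (1 / 12)).congr_right (g₂ := fun h : ℝ => h ^ 4) (fun h => by ring)
  exact ((e1.add e2).add e3).congr_left (fun h => by ring)

theorem subgrid_nonlinear_stencil (u : ℝ → ℝ → ℝ)
    (hu : ContDiff ℝ 4 (fun q : ℝ × ℝ => u q.1 q.2)) (x y : ℝ) :
    (fun h : ℝ =>
        ((1 / 12) * stencil2 h (fun x' y' => u x' y' ^ 3) x y
          - (1 / 4) * u x y ^ 2 * stencil2 h u x y)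
        - (h^2 / 2) * u x y *
            ((deriv (fun x' => u x' y) x)^2 + (deriv (fun y' => u x y') y)^2))
      =O[nhds (0:ℝ)] (fun h : ℝ => h^4) := by
  have hx : ContDiff ℝ 4 (fun x' => u x' y) :=
    hu.comp (contDiff_id.prodMk contDiff_const)
  have hy : ContDiff ℝ 4 (fun y' => u x y') :=
    hu.comp (contDiff_const.prodMk contDiff_id)
  refine ((stencil_one_dim _ hx x).add (stencil_one_dim _ hy y)).congr_left ?_
  intro h
  simp only [stencil2, cdiffX, cdiffY]
  ring
end

section
/- Let f > 0, h > 0, X, Y ∈ ℝ, and let k, l be nonnegative integers. Define λ = −f(k² + l²)π²/h² and v(x,y,t) = e^{λ t} · cos(kπ(x − X + h/2)/h) · cos(lπ(y − Y + h/2)/h). Then: (i) v satisfies the constant-coefficient diffusion equation ∂v/∂t = f(∂²v/∂x² + ∂²v/∂y²) at every (x,y,t) ∈ ℝ³; and (ii) v satisfies the decoupled coupling conditions v(X+h, y, t) = v(X−h, y, t) = v(X, y, t) for all y, t and v(x, Y+h, t) = v(x, Y−h, t) = v(x, Y, t) for all x, t. -/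
open Real Filter

theorem aux_iter (c w d h p : ℝ) (x : ℝ) :
    iteratedDeriv 2 (fun x' => c * Real.cos (w * (x' - d + p) / h)) x
      = -(w / h) ^ 2 * (c * Real.cos (w * (x - d + p) / h)) := by
  have hin : ∀ z : ℝ, HasDerivAt (fun x' : ℝ => w * (x' - d + p) / h) (w / h) z := by
    intro z
    have := ((((hasDerivAt_id z).sub_const d).add_const p).const_mul w).div_const h
    simpa using this
  have h1 : deriv (fun x' => c * Real.cos (w * (x' - d + p) / h))
      = fun x' => c * (-Real.sin (w * (x' - d + p) / h) * (w / h)) := by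
    funext z
    exact ((hin z).cos.const_mul c).deriv
  rw [iteratedDeriv_succ, iteratedDeriv_one, h1]
  refine ((((hin x).sin.neg).mul_const (w / h)).const_mul c).deriv.trans ?_
  ring

theorem aux_bc (k : ℕ) (X h : ℝ) (hh : 0 < h) :
    Real.cos ((k:ℝ) * Real.pi * (X + h - X + h / 2) / h)
      = Real.cos ((k:ℝ) * Real.pi * (X - h - X + h / 2) / h) ∧
    Real.cos ((k:ℝ) * Real.pi * (X + h - X + h / 2) / h)
      = Real.cos ((k:ℝ) * Real.pi * (X - X + h / 2) / h) := by
  have e1 : (k:ℝ) * Real.pi * (X + h - X + h / 2) / h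
      = (k:ℝ) * (2 * Real.pi) - k * Real.pi / 2 := by field_simp; ring
  have e2 : (k:ℝ) * Real.pi * (X - h - X + h / 2) / h = -(k * Real.pi / 2) := by
    field_simp; ring
  have e3 : (k:ℝ) * Real.pi * (X - X + h / 2) / h = k * Real.pi / 2 := by
    field_simp; ring
  rw [e1, e2, e3, Real.cos_nat_mul_two_pi_sub, Real.cos_neg]
  exact ⟨rfl, rfl⟩

theorem diffusion_eigenmode (f h X Y : ℝ) (hf : 0 < f) (hh : 0 < h)
    (k l : ℕ) (lam : ℝ) (hlam : lam = -f * ((k:ℝ)^2 + (l:ℝ)^2) * Real.pi^2 / h^2)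
    (v : ℝ → ℝ → ℝ → ℝ)
    (hv : v = fun x y t => Real.exp (lam * t) *
        Real.cos ((k:ℝ) * Real.pi * (x - X + h / 2) / h) *
        Real.cos ((l:ℝ) * Real.pi * (y - Y + h / 2) / h)) :
    (∀ x y t : ℝ,
        deriv (fun t' => v x y t') t =
          f * (iteratedDeriv 2 (fun x' => v x' y t) x
               + iteratedDeriv 2 (fun y' => v x y' t) y)) ∧
    (∀ y t : ℝ, v (X + h) y t = v (X - h) y t ∧ v (X + h) y t = v X y t) ∧
    (∀ x t : ℝ, v x (Y + h) t = v x (Y - h) t ∧ v x (Y + h) t = v x Y t) := by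
  subst hv
  refine ⟨fun x y t => ?_, fun y t => ?_, fun x t => ?_⟩
  · have ht : deriv (fun t' => Real.exp (lam * t') *
        Real.cos ((k:ℝ) * Real.pi * (x - X + h / 2) / h) *
        Real.cos ((l:ℝ) * Real.pi * (y - Y + h / 2) / h)) t = lam * (Real.exp (lam * t) *
        Real.cos ((k:ℝ) * Real.pi * (x - X + h / 2) / h) *
        Real.cos ((l:ℝ) * Real.pi * (y - Y + h / 2) / h)) := by
      have h0 : HasDerivAt (fun t' : ℝ => lam * t') lam t := by
        simpa using (hasDerivAt_id t).const_mul lam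
      rw [((h0.exp.mul_const _).mul_const _).deriv]
      ring
    have hx := aux_iter (Real.exp (lam * t) * Real.cos ((l:ℝ) * Real.pi * (y - Y + h / 2) / h))
      ((k:ℝ) * Real.pi) X h (h / 2) x
    have hy := aux_iter (Real.exp (lam * t) * Real.cos ((k:ℝ) * Real.pi * (x - X + h / 2) / h))
      ((l:ℝ) * Real.pi) Y h (h / 2) y
    simp only [mul_right_comm (Real.exp (lam * t))
      (Real.cos ((l:ℝ) * Real.pi * (y - Y + h / 2) / h))] at hx
    beta_reduce
    rw [ht, hx, hy]
    generalize Real.exp (lam * t) = E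
    rw [hlam]
    ring
  · obtain ⟨a, b⟩ := aux_bc k X h hh
    beta_reduce
    exact ⟨by rw [a], by rw [b]⟩
  · obtain ⟨a, b⟩ := aux_bc l Y h hh
    beta_reduce
    exact ⟨by rw [a], by rw [b]⟩
end

section
/- Fix h > 0 and (X,Y) ∈ ℝ², let E = [X−h, X+h] × [Y−h, Y+h] and w(x,y) = (1 − |x−X|/h)(1 − |y−Y|/h), and let v : ℝ² → ℝ be twice continuously differentiable on an open set containing E. Then ∬_E (∂²v/∂x² + ∂²v/∂y²)(x,y) · w(x,y) dx dy = (1/h) ∫_{Y−h}^{Y+h} (1 − |y−Y|/h) [v(X+h,y) − 2v(X,y) + v(X−h,y)] dy + (1/h) ∫_{X−h}^{X+h} (1 − |x−X|/h) [v(x,Y+h) − 2v(x,Y) + v(x,Y−h)] dx. -/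
open Real Filter intervalIntegral

lemma hat_one_dim (h a : ℝ) (hh : 0 < h) (f f' f'' : ℝ → ℝ)
    (h1 : ∀ x ∈ Set.Icc (a - h) (a + h), HasDerivAt f (f' x) x)
    (h2 : ∀ x ∈ Set.Icc (a - h) (a + h), HasDerivAt f' (f'' x) x)
    (hc : ContinuousOn f'' (Set.Icc (a - h) (a + h))) :
    ∫ x in (a - h)..(a + h), f'' x * (1 - |x - a| / h)
      = (1 / h) * (f (a + h) - 2 * f a + f (a - h)) := by
  have hcw : ContinuousOn (fun x => f'' x * (1 - |x - a| / h)) (Set.Icc (a - h) (a + h)) :=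
    hc.mul (by fun_prop)
  have iL : IntervalIntegrable (fun x => f'' x * (1 - |x - a| / h)) MeasureTheory.volume
      (a - h) a := by
    apply ContinuousOn.intervalIntegrable_of_Icc (by linarith)
    exact hcw.mono (Set.Icc_subset_Icc_right (by linarith))
  have iR : IntervalIntegrable (fun x => f'' x * (1 - |x - a| / h)) MeasureTheory.volume
      a (a + h) := by
    apply ContinuousOn.intervalIntegrable_of_Icc (by linarith)
    exact hcw.mono (Set.Icc_subset_Icc_left (by linarith))
  rw [← integral_add_adjacent_intervals iL iR]
  have eL := integral_eq_sub_of_hasDerivAt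
    (f := fun x => f' x * (1 + (x - a) / h) - f x / h) (a := a - h) (b := a)
    (f' := fun x => f'' x * (1 - |x - a| / h)) (by
      intro x hx
      rw [Set.uIcc_of_le (by linarith)] at hx
      have hx' : x ∈ Set.Icc (a - h) (a + h) := ⟨hx.1, by linarith [hx.2]⟩
      have hl : HasDerivAt (fun x : ℝ => 1 + (x - a) / h) (1 / h) x :=
        (((hasDerivAt_id x).sub_const a).div_const h).const_add 1
      convert ((h2 x hx').mul hl).sub ((h1 x hx').div_const h) using 1
      · rfl
      rw [abs_of_nonpos (by linarith [hx.2])]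
      ring) iL
  have eR := integral_eq_sub_of_hasDerivAt
    (f := fun x => f' x * (1 - (x - a) / h) + f x / h) (a := a) (b := a + h)
    (f' := fun x => f'' x * (1 - |x - a| / h)) (by
      intro x hx
      rw [Set.uIcc_of_le (by linarith)] at hx
      have hx' : x ∈ Set.Icc (a - h) (a + h) := ⟨by linarith [hx.1], hx.2⟩
      have hl : HasDerivAt (fun x : ℝ => 1 - (x - a) / h) (-(1 / h)) x :=
        (((hasDerivAt_id x).sub_const a).div_const h).const_sub 1
      convert ((h2 x hx').mul hl).add ((h1 x hx').div_const h) using 1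
      · rfl
      rw [abs_of_nonneg (by linarith [hx.1])]
      ring) iR
  rw [eL, eR]
  field_simp
  ring

lemma line_derivs (g : ℝ × ℝ → ℝ) (U : Set (ℝ × ℝ)) (hU : IsOpen U)
    (hg : ContDiffOn ℝ 2 g U) (e : ℝ × ℝ) :
    ∃ G D : ℝ × ℝ → ℝ, ContinuousOn D U ∧ ∀ c : ℝ → ℝ × ℝ, (∀ t, HasDerivAt c e t) →
      ∀ t, c t ∈ U → HasDerivAt (fun s => g (c s)) (G (c t)) t ∧
        HasDerivAt (fun s => G (c s)) (D (c t)) t ∧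
        iteratedDeriv 2 (fun s => g (c s)) t = D (c t) := by
  have hG : ContDiffOn ℝ 1 (fun p => fderiv ℝ g p e) U :=
    (hg.fderiv_of_isOpen hU (m := 1) (by norm_num)).clm_apply contDiffOn_const
  refine ⟨fun p => fderiv ℝ g p e, fun q => fderiv ℝ (fun p => fderiv ℝ g p e) q e,
    (hG.continuousOn_fderiv_of_isOpen hU le_rfl).clm_apply continuousOn_const, ?_⟩
  intro c hc t ht
  have key : ∀ s, c s ∈ U → HasDerivAt (fun s => g (c s)) (fderiv ℝ g (c s) e) s := by
    intro s hs
    exact ((hg.contDiffAt (hU.mem_nhds hs)).differentiableAt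
      (by norm_num)).hasFDerivAt.comp_hasDerivAt s (hc s)
  have key2 : HasDerivAt (fun s => fderiv ℝ g (c s) e)
      (fderiv ℝ (fun p => fderiv ℝ g p e) (c t) e) t :=
    ((hG.contDiffAt (hU.mem_nhds ht)).differentiableAt
      (by norm_num)).hasFDerivAt.comp_hasDerivAt t (hc t)
  refine ⟨key t ht, key2, ?_⟩
  rw [iteratedDeriv_succ, iteratedDeriv_one]
  refine Eq.trans ?_ key2.deriv
  apply Filter.EventuallyEq.deriv_eq
  filter_upwards [(hc t).continuousAt.preimage_mem_nhds (hU.mem_nhds ht)] with s hs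
  exact (key s hs).deriv

theorem pyramid_green_identity (h X Y : ℝ) (hh : 0 < h)
    (w : ℝ → ℝ → ℝ)
    (hw : w = fun x y => (1 - |x - X| / h) * (1 - |y - Y| / h))
    (v : ℝ → ℝ → ℝ)
    (hv : ∃ U : Set (ℝ × ℝ), IsOpen U ∧
        (Set.Icc (X - h) (X + h) ×ˢ Set.Icc (Y - h) (Y + h)) ⊆ U ∧
        ContDiffOn ℝ 2 (fun q : ℝ × ℝ => v q.1 q.2) U) :
    (∫ x in (X - h)..(X + h), ∫ y in (Y - h)..(Y + h),
        (iteratedDeriv 2 (fun x' => v x' y) x + iteratedDeriv 2 (fun y' => v x y') y)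
          * w x y) =
      (1 / h) * (∫ y in (Y - h)..(Y + h),
          (1 - |y - Y| / h) * (v (X + h) y - 2 * v X y + v (X - h) y))
      + (1 / h) * (∫ x in (X - h)..(X + h),
          (1 - |x - X| / h) * (v x (Y + h) - 2 * v x Y + v x (Y - h))) := by
  obtain ⟨U, hU, hEU, hg⟩ := hv
  obtain ⟨G₁, D₁, hD₁, L₁⟩ := line_derivs _ U hU hg (1, 0)
  obtain ⟨G₂, D₂, hD₂, L₂⟩ := line_derivs _ U hU hg (0, 1)
  have c₁ : ∀ y t : ℝ, HasDerivAt (fun s : ℝ => (s, y)) ((1 : ℝ), (0 : ℝ)) t := fun y t =>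
    (hasDerivAt_id t).prodMk (hasDerivAt_const t y)
  have c₂ : ∀ x t : ℝ, HasDerivAt (fun s : ℝ => (x, s)) ((0 : ℝ), (1 : ℝ)) t := fun x t =>
    (hasDerivAt_const t x).prodMk (hasDerivAt_id t)
  have mem : ∀ x ∈ Set.Icc (X - h) (X + h), ∀ y ∈ Set.Icc (Y - h) (Y + h), (x, y) ∈ U :=
    fun x hx y hy => hEU ⟨hx, hy⟩
  have hX : X - h ≤ X + h := by linarith
  have hY : Y - h ≤ Y + h := by linarith
  have slice₁ : ∀ y ∈ Set.Icc (Y - h) (Y + h),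
      ∫ x in (X - h)..(X + h), D₁ (x, y) * (1 - |x - X| / h)
        = (1 / h) * (v (X + h) y - 2 * v X y + v (X - h) y) := by
    intro y hy
    refine hat_one_dim h X hh (fun x => v x y) (fun x => G₁ (x, y)) (fun x => D₁ (x, y))
      (fun x hx => (L₁ _ (c₁ y) x (mem x hx y hy)).1)
      (fun x hx => (L₁ _ (c₁ y) x (mem x hx y hy)).2.1)
      (hD₁.comp (by fun_prop) (fun x hx => mem x hx y hy))
  have slice₂ : ∀ x ∈ Set.Icc (X - h) (X + h),
      ∫ y in (Y - h)..(Y + h), D₂ (x, y) * (1 - |y - Y| / h)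
        = (1 / h) * (v x (Y + h) - 2 * v x Y + v x (Y - h)) := by
    intro x hx
    refine hat_one_dim h Y hh (fun y => v x y) (fun y => G₂ (x, y)) (fun y => D₂ (x, y))
      (fun y hy => (L₂ _ (c₂ x) y (mem x hx y hy)).1)
      (fun y hy => (L₂ _ (c₂ x) y (mem x hx y hy)).2.1)
      (hD₂.comp (by fun_prop) (fun y hy => mem x hx y hy))
  have hwc : Continuous (fun q : ℝ × ℝ => w q.1 q.2) := by
    subst hw; fun_prop
  have int2 : ∀ D : ℝ × ℝ → ℝ, ContinuousOn D U →
      MeasureTheory.IntegrableOn (Function.uncurry fun x y => D (x, y) * w x y)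
        (Set.Icc (X - h) (X + h) ×ˢ Set.Icc (Y - h) (Y + h)) := by
    intro D hD
    apply ContinuousOn.integrableOn_compact (isCompact_Icc.prod isCompact_Icc)
    exact (hD.mono hEU).mul hwc.continuousOn
  have int1 : ∀ D : ℝ × ℝ → ℝ, ContinuousOn D U → ∀ x ∈ Set.Icc (X - h) (X + h),
      IntervalIntegrable (fun y => D (x, y) * w x y) MeasureTheory.volume (Y - h) (Y + h) := by
    intro D hD x hx
    apply ContinuousOn.intervalIntegrable_of_Icc hY
    refine ContinuousOn.mul (hD.comp (by fun_prop) (fun y hy => mem x hx y hy)) ?_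
    exact (hwc.comp (by fun_prop : Continuous fun y : ℝ => (x, y))).continuousOn
  have int3 : ∀ D : ℝ × ℝ → ℝ, ContinuousOn D U →
      IntervalIntegrable (fun x => ∫ y in (Y - h)..(Y + h), D (x, y) * w x y)
        MeasureTheory.volume (X - h) (X + h) := by
    intro D hD
    rw [intervalIntegrable_iff_integrableOn_Ioc_of_le hX]
    simp_rw [integral_of_le hY]
    have := (int2 D hD).mono_set (Set.prod_mono Set.Ioc_subset_Icc_self Set.Ioc_subset_Icc_self)
    rw [MeasureTheory.IntegrableOn, MeasureTheory.Measure.volume_eq_prod,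
      ← MeasureTheory.Measure.prod_restrict] at this
    exact this.integral_prod_left
  have step1 : (∫ x in (X - h)..(X + h), ∫ y in (Y - h)..(Y + h),
        (iteratedDeriv 2 (fun x' => v x' y) x + iteratedDeriv 2 (fun y' => v x y') y)
          * w x y) = ∫ x in (X - h)..(X + h), ((∫ y in (Y - h)..(Y + h), D₁ (x, y) * w x y)
            + ∫ y in (Y - h)..(Y + h), D₂ (x, y) * w x y) := by
    apply integral_congr
    intro x hx
    rw [Set.uIcc_of_le hX] at hx
    simp only
    rw [← integral_add (int1 D₁ hD₁ x hx) (int1 D₂ hD₂ x hx)]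
    apply integral_congr
    intro y hy
    rw [Set.uIcc_of_le hY] at hy
    have e₁ := (L₁ _ (c₁ y) x (mem x hx y hy)).2.2
    have e₂ := (L₂ _ (c₂ x) y (mem x hx y hy)).2.2
    simp only at e₁ e₂ ⊢
    rw [e₁, e₂, add_mul]
  rw [step1, integral_add (int3 D₁ hD₁) (int3 D₂ hD₂)]
  congr 1
  · rw [MeasureTheory.intervalIntegral_intervalIntegral_swap, ← integral_const_mul]
    · apply integral_congr
      intro y hy
      rw [Set.uIcc_of_le hY] at hy
      simp only
      rw [mul_left_comm, ← slice₁ y hy, ← integral_const_mul]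
      subst hw
      congr 1
      ext x
      ring
    · rw [Set.uIoc_of_le hX, Set.uIoc_of_le hY]
      exact (int2 D₁ hD₁).mono_set
        (Set.prod_mono Set.Ioc_subset_Icc_self Set.Ioc_subset_Icc_self)
  · rw [← integral_const_mul]
    apply integral_congr
    intro x hx
    rw [Set.uIcc_of_le hX] at hx
    simp only
    rw [mul_left_comm, ← slice₂ x hx, ← integral_const_mul]
    subst hw
    congr 1
    ext y
    ring
end

section
/- Fix h > 0 and (X,Y) ∈ ℝ², let E = [X−h, X+h] × [Y−h, Y+h] and w(x,y) = (1 − |x−X|/h)(1 − |y−Y|/h), and let v : ℝ² → ℝ be twice continuously differentiable on an open set containing E and satisfy the decoupled coupling conditions: v(X+h, y) = v(X−h, y) = v(X, y) for all y ∈ [Y−h, Y+h] and v(x, Y+h) = v(x, Y−h) = v(x, Y) for all x ∈ [X−h, X+h]. Then ∬_E (∂²v/∂x² + ∂²v/∂y²)(x,y) · w(x,y) dx dy = 0. -/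
open Real Filter intervalIntegral

lemma pyr_oneD (a h : ℝ) (hh : 0 < h) (f f' f'' : ℝ → ℝ)
    (h1 : ∀ x ∈ Set.Icc (a - h) (a + h), HasDerivAt f (f' x) x)
    (h2 : ∀ x ∈ Set.Icc (a - h) (a + h), HasDerivAt f' (f'' x) x)
    (hc : ContinuousOn f'' (Set.Icc (a - h) (a + h)))
    (hp : f (a + h) = f a) (hm : f (a - h) = f a) :
    ∫ x in (a - h)..(a + h), f'' x * (1 - |x - a| / h) = 0 := by
  have hne : h ≠ 0 := hh.ne'
  have hcw : ContinuousOn (fun x => f'' x * (1 - |x - a| / h)) (Set.Icc (a - h) (a + h)) :=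
    hc.mul (by fun_prop)
  have i1 : IntervalIntegrable (fun x => f'' x * (1 - |x - a| / h)) MeasureTheory.volume (a - h) a := by
    apply ContinuousOn.intervalIntegrable
    rw [Set.uIcc_of_le (by linarith)]
    exact hcw.mono (Set.Icc_subset_Icc le_rfl (by linarith))
  have i2 : IntervalIntegrable (fun x => f'' x * (1 - |x - a| / h)) MeasureTheory.volume a (a + h) := by
    apply ContinuousOn.intervalIntegrable
    rw [Set.uIcc_of_le (by linarith)]
    exact hcw.mono (Set.Icc_subset_Icc (by linarith) le_rfl)
  have e1 : ∫ x in (a - h)..a, f'' x * (1 - |x - a| / h) = f' a := by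
    have := integral_eq_sub_of_hasDerivAt_of_le (a := a - h) (b := a) (by linarith)
      (f := fun x => f' x * (1 + (x - a) / h) - f x / h)
      (f' := fun x => f'' x * (1 - |x - a| / h)) ?_ ?_ i1
    · rw [this, hm]
      field_simp
      ring
    · intro x hx
      have hx' : x ∈ Set.Icc (a - h) (a + h) := ⟨hx.1, by linarith [hx.2]⟩
      have c1 := (h1 x hx').continuousAt
      have c2 := (h2 x hx').continuousAt
      exact ContinuousAt.continuousWithinAt (by fun_prop)
    · intro x hx
      have hx' : x ∈ Set.Icc (a - h) (a + h) := ⟨hx.1.le, by linarith [hx.2]⟩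
      have d := ((h2 x hx').mul ((((hasDerivAt_id x).sub_const a).div_const h).const_add 1)).sub
        ((h1 x hx').div_const h)
      refine d.congr_deriv ?_
      rw [abs_of_nonpos (by linarith [hx.2])]
      simp only [id]
      ring
  have e2 : ∫ x in a..(a + h), f'' x * (1 - |x - a| / h) = - f' a := by
    have := integral_eq_sub_of_hasDerivAt_of_le (a := a) (b := a + h) (by linarith)
      (f := fun x => f' x * (1 - (x - a) / h) + f x / h)
      (f' := fun x => f'' x * (1 - |x - a| / h)) ?_ ?_ i2
    · rw [this, hp]
      field_simp
      ring
    · intro x hx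
      have hx' : x ∈ Set.Icc (a - h) (a + h) := ⟨by linarith [hx.1], hx.2⟩
      have c1 := (h1 x hx').continuousAt
      have c2 := (h2 x hx').continuousAt
      exact ContinuousAt.continuousWithinAt (by fun_prop)
    · intro x hx
      have hx' : x ∈ Set.Icc (a - h) (a + h) := ⟨by linarith [hx.1], hx.2.le⟩
      have d := ((h2 x hx').mul ((((hasDerivAt_id x).sub_const a).div_const h).const_sub 1)).add
        ((h1 x hx').div_const h)
      refine d.congr_deriv ?_
      rw [abs_of_nonneg (by linarith [hx.1])]
      simp only [id]
      ring
  rw [← integral_add_adjacent_intervals i1 i2, e1, e2]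
  ring

noncomputable def pyrD2 (g : ℝ × ℝ → ℝ) (e q : ℝ × ℝ) : ℝ :=
  fderiv ℝ (fun p => fderiv ℝ g p e) q e

lemma pyr_D1_contDiff (g : ℝ × ℝ → ℝ) (U : Set (ℝ × ℝ)) (hU : IsOpen U)
    (hg : ContDiffOn ℝ 2 g U) (e : ℝ × ℝ) : ContDiffOn ℝ 1 (fun p => fderiv ℝ g p e) U :=
  (hg.fderiv_of_isOpen hU (by norm_num)).clm_apply contDiffOn_const

lemma pyr_D2_cont (g : ℝ × ℝ → ℝ) (U : Set (ℝ × ℝ)) (hU : IsOpen U)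
    (hg : ContDiffOn ℝ 2 g U) (e : ℝ × ℝ) : ContinuousOn (pyrD2 g e) U :=
  ((pyr_D1_contDiff g U hU hg e).continuousOn_fderiv_of_isOpen hU le_rfl).clm_apply
    continuousOn_const

lemma pyr_line1 (g : ℝ × ℝ → ℝ) (U : Set (ℝ × ℝ)) (hU : IsOpen U)
    (hg : ContDiffOn ℝ 2 g U) (e : ℝ × ℝ) (c : ℝ → ℝ × ℝ) (hc : ∀ t, HasDerivAt c e t)
    (t : ℝ) (ht : c t ∈ U) :
    HasDerivAt (fun s => g (c s)) (fderiv ℝ g (c t) e) t :=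
  (((hg.differentiableOn (by norm_num)).differentiableAt
    (hU.mem_nhds ht)).hasFDerivAt).comp_hasDerivAt t (hc t)

lemma pyr_line2 (g : ℝ × ℝ → ℝ) (U : Set (ℝ × ℝ)) (hU : IsOpen U)
    (hg : ContDiffOn ℝ 2 g U) (e : ℝ × ℝ) (c : ℝ → ℝ × ℝ) (hc : ∀ t, HasDerivAt c e t)
    (t : ℝ) (ht : c t ∈ U) :
    HasDerivAt (fun s => fderiv ℝ g (c s) e) (pyrD2 g e (c t)) t :=
  ((((pyr_D1_contDiff g U hU hg e).differentiableOn (by norm_num)).differentiableAt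
    (hU.mem_nhds ht)).hasFDerivAt).comp_hasDerivAt t (hc t)

lemma pyr_iter (g : ℝ × ℝ → ℝ) (U : Set (ℝ × ℝ)) (hU : IsOpen U)
    (hg : ContDiffOn ℝ 2 g U) (e : ℝ × ℝ) (c : ℝ → ℝ × ℝ) (hc : ∀ t, HasDerivAt c e t)
    (t : ℝ) (ht : c t ∈ U) :
    iteratedDeriv 2 (fun s => g (c s)) t = pyrD2 g e (c t) := by
  rw [iteratedDeriv_succ, iteratedDeriv_one]
  have : deriv (fun s => g (c s)) =ᶠ[nhds t] fun s => fderiv ℝ g (c s) e := by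
    filter_upwards [(hc t).continuousAt.preimage_mem_nhds (hU.mem_nhds ht)] with s hs
    exact (pyr_line1 g U hU hg e c hc s hs).deriv
  rw [this.deriv_eq]
  exact (pyr_line2 g U hU hg e c hc t ht).deriv

theorem pyramid_solvability_condition (h X Y : ℝ) (hh : 0 < h)
    (w : ℝ → ℝ → ℝ)
    (hw : w = fun x y => (1 - |x - X| / h) * (1 - |y - Y| / h))
    (v : ℝ → ℝ → ℝ)
    (hv : ∃ U : Set (ℝ × ℝ), IsOpen U ∧
        (Set.Icc (X - h) (X + h) ×ˢ Set.Icc (Y - h) (Y + h)) ⊆ U ∧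
        ContDiffOn ℝ 2 (fun q : ℝ × ℝ => v q.1 q.2) U)
    (hcx : ∀ y ∈ Set.Icc (Y - h) (Y + h), v (X + h) y = v X y ∧ v (X - h) y = v X y)
    (hcy : ∀ x ∈ Set.Icc (X - h) (X + h), v x (Y + h) = v x Y ∧ v x (Y - h) = v x Y) :
    (∫ x in (X - h)..(X + h), ∫ y in (Y - h)..(Y + h),
        (iteratedDeriv 2 (fun x' => v x' y) x + iteratedDeriv 2 (fun y' => v x y') y)
          * w x y) = 0 := by
  obtain ⟨U, hU, hEU, hg⟩ := hv
  set g : ℝ × ℝ → ℝ := fun q => v q.1 q.2 with hgdef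
  have hlx : ∀ y t : ℝ, HasDerivAt (fun s : ℝ => (s, y)) ((1 : ℝ), (0 : ℝ)) t := fun y t =>
    (hasDerivAt_id t).prodMk (hasDerivAt_const t y)
  have hly : ∀ x t : ℝ, HasDerivAt (fun s : ℝ => (x, s)) ((0 : ℝ), (1 : ℝ)) t := fun x t =>
    (hasDerivAt_const t x).prodMk (hasDerivAt_id t)
  have hXle : X - h ≤ X + h := by linarith
  have hYle : Y - h ≤ Y + h := by linarith
  have cA := pyr_D2_cont g U hU hg (1, 0)
  have cB := pyr_D2_cont g U hU hg (0, 1)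
  set A := pyrD2 g (1, 0)
  set B := pyrD2 g (0, 1)
  have iA : ∀ x ∈ Set.Icc (X - h) (X + h), ∀ y ∈ Set.Icc (Y - h) (Y + h),
      iteratedDeriv 2 (fun x' => v x' y) x = A (x, y) := fun x hx y hy =>
    pyr_iter g U hU hg (1, 0) (fun s => (s, y)) (hlx y) x (hEU ⟨hx, hy⟩)
  have iB : ∀ x ∈ Set.Icc (X - h) (X + h), ∀ y ∈ Set.Icc (Y - h) (Y + h),
      iteratedDeriv 2 (fun y' => v x y') y = B (x, y) := fun x hx y hy =>
    pyr_iter g U hU hg (0, 1) (fun s => (x, s)) (hly x) y (hEU ⟨hx, hy⟩)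
  have cAx : ∀ y ∈ Set.Icc (Y - h) (Y + h),
      ContinuousOn (fun x => A (x, y)) (Set.Icc (X - h) (X + h)) := fun y hy =>
    cA.comp (by fun_prop) (fun x hx => hEU ⟨hx, hy⟩)
  have cAy : ∀ x ∈ Set.Icc (X - h) (X + h),
      ContinuousOn (fun y => A (x, y)) (Set.Icc (Y - h) (Y + h)) := fun x hx =>
    cA.comp (by fun_prop) (fun y hy => hEU ⟨hx, hy⟩)
  have cBy : ∀ x ∈ Set.Icc (X - h) (X + h),
      ContinuousOn (fun y => B (x, y)) (Set.Icc (Y - h) (Y + h)) := fun x hx =>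
    cB.comp (by fun_prop) (fun y hy => hEU ⟨hx, hy⟩)
  have zA : ∀ y ∈ Set.Icc (Y - h) (Y + h),
      ∫ x in (X - h)..(X + h), A (x, y) * (1 - |x - X| / h) = 0 := fun y hy =>
    pyr_oneD X h hh (fun x => g (x, y)) (fun x => fderiv ℝ g (x, y) (1, 0)) (fun x => A (x, y))
      (fun x hx => pyr_line1 g U hU hg (1, 0) (fun s => (s, y)) (hlx y) x (hEU ⟨hx, hy⟩))
      (fun x hx => pyr_line2 g U hU hg (1, 0) (fun s => (s, y)) (hlx y) x (hEU ⟨hx, hy⟩))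
      (cAx y hy) (hcx y hy).1 (hcx y hy).2
  have zB : ∀ x ∈ Set.Icc (X - h) (X + h),
      ∫ y in (Y - h)..(Y + h), B (x, y) * (1 - |y - Y| / h) = 0 := fun x hx =>
    pyr_oneD Y h hh (fun y => g (x, y)) (fun y => fderiv ℝ g (x, y) (0, 1)) (fun y => B (x, y))
      (fun y hy => pyr_line1 g U hU hg (0, 1) (fun s => (x, s)) (hly x) y (hEU ⟨hx, hy⟩))
      (fun y hy => pyr_line2 g U hU hg (0, 1) (fun s => (x, s)) (hly x) y (hEU ⟨hx, hy⟩))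
      (cBy x hx) (hcy x hx).1 (hcy x hx).2
  have inner : ∀ x ∈ Set.Icc (X - h) (X + h),
      (∫ y in (Y - h)..(Y + h),
        (iteratedDeriv 2 (fun x' => v x' y) x + iteratedDeriv 2 (fun y' => v x y') y) * w x y)
      = ∫ y in (Y - h)..(Y + h), A (x, y) * ((1 - |x - X| / h) * (1 - |y - Y| / h)) := by
    intro x hx
    have s1 : (∫ y in (Y - h)..(Y + h),
        (iteratedDeriv 2 (fun x' => v x' y) x + iteratedDeriv 2 (fun y' => v x y') y) * w x y)
      = ∫ y in (Y - h)..(Y + h), (A (x, y) * ((1 - |x - X| / h) * (1 - |y - Y| / h))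
          + (1 - |x - X| / h) * (B (x, y) * (1 - |y - Y| / h))) := by
      apply integral_congr
      intro y hy
      rw [Set.uIcc_of_le hYle] at hy
      simp only [iA x hx y hy, iB x hx y hy, hw]
      ring
    rw [s1, integral_add, integral_const_mul, zB x hx, mul_zero, add_zero]
    · apply ContinuousOn.intervalIntegrable
      rw [Set.uIcc_of_le hYle]
      exact (cAy x hx).mul (by fun_prop)
    · apply ContinuousOn.intervalIntegrable
      rw [Set.uIcc_of_le hYle]
      exact continuousOn_const.mul ((cBy x hx).mul (by fun_prop))
  have s2 : (∫ x in (X - h)..(X + h), ∫ y in (Y - h)..(Y + h),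
        (iteratedDeriv 2 (fun x' => v x' y) x + iteratedDeriv 2 (fun y' => v x y') y) * w x y)
      = ∫ x in (X - h)..(X + h), ∫ y in (Y - h)..(Y + h),
          A (x, y) * ((1 - |x - X| / h) * (1 - |y - Y| / h)) := by
    apply integral_congr
    intro x hx
    rw [Set.uIcc_of_le hXle] at hx
    exact inner x hx
  have hint : MeasureTheory.IntegrableOn
      (fun q : ℝ × ℝ => A q * ((1 - |q.1 - X| / h) * (1 - |q.2 - Y| / h)))
      (Set.Icc (X - h) (X + h) ×ˢ Set.Icc (Y - h) (Y + h)) := by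
    apply ContinuousOn.integrableOn_compact (isCompact_Icc.prod isCompact_Icc)
    exact (cA.mono hEU).mul (by fun_prop)
  rw [s2]
  simp only [integral_of_le hXle, integral_of_le hYle]
  rw [MeasureTheory.integral_integral_swap]
  · rw [MeasureTheory.setIntegral_congr_fun measurableSet_Ioc (g := fun _ => (0 : ℝ))]
    · simp
    · intro y hy
      have hy' := Set.Ioc_subset_Icc_self hy
      simp only
      rw [← integral_of_le hXle]
      have : ∀ x, A (x, y) * ((1 - |x - X| / h) * (1 - |y - Y| / h))
        = A (x, y) * (1 - |x - X| / h) * (1 - |y - Y| / h) := fun x => by ring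
      simp only [this]
      rw [integral_mul_const, zA y hy', zero_mul]
  · have := hint.mono_set (Set.prod_mono (Set.Ioc_subset_Icc_self) (Set.Ioc_subset_Icc_self))
    rw [MeasureTheory.Measure.prod_restrict]
    exact this
end

section
/- Fix h > 0 and (X,Y) ∈ ℝ² and let E = [X−h, X+h] × [Y−h, Y+h], divided by the lines x = X and y = Y into the four closed subrectangles A = [X−h,X]×[Y−h,Y], B = [X,X+h]×[Y−h,Y], C = [X−h,X]×[Y,Y+h], D = [X,X+h]×[Y,Y+h]. Let w : ℝ² → ℝ be continuous on E and vanish on the boundary of E, and suppose there exist twice continuously differentiable harmonic functions w_A, w_B, w_C, w_D : ℝ² → ℝ (each satisfying ∂²w_s/∂x² + ∂²w_s/∂y² = 0) agreeing with w on A, B, C, D respectively, and satisfying the jump conditions: for all y ∈ [Y−h, Y], ∂ₓw_A(X−h,y) − ∂ₓw_A(X,y) + ∂ₓw_B(X,y) − ∂ₓw_B(X+h,y) = 0; for all y ∈ [Y, Y+h], ∂ₓw_C(X−h,y) − ∂ₓw_C(X,y) + ∂ₓw_D(X,y) − ∂ₓw_D(X+h,y) = 0; for all x ∈ [X−h, X],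 ∂_y w_A(x,Y−h) − ∂_y w_A(x,Y) + ∂_y w_C(x,Y) − ∂_y w_C(x,Y+h) = 0; and for all x ∈ [X, X+h], ∂_y w_B(x,Y−h) − ∂_y w_B(x,Y) + ∂_y w_D(x,Y) − ∂_y w_D(x,Y+h) = 0. Then for every v : ℝ² → ℝ twice continuously differentiable on an open set containing E and satisfying the decoupled coupling conditions v(X+h,y) = v(X−h,y) = v(X,y) for all y ∈ [Y−h,Y+h] and v(x,Y+h) = v(x,Y−h) = v(x,Y) for all x ∈ [X−h,X+h], one has ∬_E (∂²v/∂x² + ∂²v/∂y²)(x,y) · w(x,y) dx dy = 0. -/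
open Real Filter intervalIntegral

/-- One-dimensional Green identity. -/
lemma green_one {a b : ℝ} (hab : a ≤ b) {V : Set ℝ} (hV : IsOpen V) (hsub : Set.Icc a b ⊆ V)
    {p f : ℝ → ℝ} (hp : ContDiffOn ℝ 2 p V) (hf : ContDiff ℝ 2 f) :
    ∫ x in a..b, (iteratedDeriv 2 p x * f x - p x * iteratedDeriv 2 f x)
      = (deriv p b * f b - p b * deriv f b) - (deriv p a * f a - p a * deriv f a) := by
  have hp1 : ContDiffOn ℝ 1 (deriv p) V := hp.deriv_of_isOpen hV (by norm_num)
  have hp2 : ContDiffOn ℝ 0 (deriv (deriv p)) V := hp1.deriv_of_isOpen hV (by norm_num)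
  have hf' : ContDiff ℝ (1 + 1) f := by convert hf using 1; norm_num
  have hf1 : ContDiff ℝ 1 (deriv f) := (contDiff_succ_iff_deriv.1 hf').2.2
  have hf2 : Continuous (deriv (deriv f)) := hf1.continuous_deriv le_rfl
  have e1 : iteratedDeriv 2 p = deriv (deriv p) := by
    rw [iteratedDeriv_succ, iteratedDeriv_one]
  have e2 : iteratedDeriv 2 f = deriv (deriv f) := by
    rw [iteratedDeriv_succ, iteratedDeriv_one]
  rw [e1, e2]
  apply integral_eq_sub_of_hasDerivAt (f := fun x => deriv p x * f x - p x * deriv f x)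
  · intro x hx
    rw [Set.uIcc_of_le hab] at hx
    have hxV := hV.mem_nhds (hsub hx)
    have d0 : HasDerivAt p (deriv p x) x :=
      ((hp.contDiffAt hxV).differentiableAt (by norm_num)).hasDerivAt
    have d1 : HasDerivAt (deriv p) (deriv (deriv p) x) x :=
      ((hp1.contDiffAt hxV).differentiableAt (by norm_num)).hasDerivAt
    have g0 : HasDerivAt f (deriv f x) x := (hf.differentiable (by norm_num) x).hasDerivAt
    have g1 : HasDerivAt (deriv f) (deriv (deriv f) x) x :=
      (hf1.differentiable (by norm_num) x).hasDerivAt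
    exact ((d1.mul g0).sub (d0.mul g1)).congr_deriv (by ring)
  · apply ContinuousOn.intervalIntegrable
    rw [Set.uIcc_of_le hab]
    exact ((hp2.continuousOn.mono hsub).mul hf.continuous.continuousOn).sub
      ((hp.continuousOn.mono hsub).mul hf2.continuousOn)

/-- Continuity of the second partial derivative in the first variable. -/
lemma cont_xx {v : ℝ → ℝ → ℝ} {U : Set (ℝ × ℝ)} (hU : IsOpen U)
    (hv : ContDiffOn ℝ 2 (fun q : ℝ × ℝ => v q.1 q.2) U) :
    ContinuousOn (fun q : ℝ × ℝ => iteratedDeriv 2 (fun x' => v x' q.2) q.1) U := by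
  set φ : ℝ × ℝ → ℝ := fun q => v q.1 q.2 with hφ
  have h1 : ContDiffOn ℝ 1 (fun q => fderiv ℝ φ q (1, 0)) U :=
    (hv.fderiv_of_isOpen hU (by norm_num)).clm_apply contDiffOn_const
  have h2 : ContDiffOn ℝ 0 (fun q => fderiv ℝ (fun q => fderiv ℝ φ q (1, 0)) q (1, 0)) U :=
    (h1.fderiv_of_isOpen hU (by norm_num)).clm_apply contDiffOn_const
  have line : ∀ x y : ℝ, HasDerivAt (fun t : ℝ => (t, y)) ((1 : ℝ), (0 : ℝ)) x := fun x y =>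
    (hasDerivAt_id x).prodMk (hasDerivAt_const x y)
  have key : ∀ (ψ : ℝ × ℝ → ℝ), ContDiffOn ℝ 1 ψ U → ∀ q ∈ U,
      HasDerivAt (fun t => ψ (t, q.2)) (fderiv ℝ ψ q (1, 0)) q.1 := by
    intro ψ hψ q hq
    have := ((hψ.contDiffAt (hU.mem_nhds hq)).differentiableAt (by norm_num)).hasFDerivAt
    exact HasFDerivAt.comp_hasDerivAt (x := q.1) (f := fun t : ℝ => (t, q.2)) this (line q.1 q.2)
  refine h2.continuousOn.congr ?_
  intro q hq
  show iteratedDeriv 2 (fun x' => v x' q.2) q.1 = _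
  rw [iteratedDeriv_succ, iteratedDeriv_one]
  have hev : deriv (fun x' => v x' q.2) =ᶠ[nhds q.1] fun t => fderiv ℝ φ (t, q.2) (1, 0) := by
    have : ∀ᶠ t in nhds q.1, (t, q.2) ∈ U :=
      (line q.1 q.2).continuousAt.eventually (hU.mem_nhds hq)
    filter_upwards [this] with t ht
    exact (key φ (hv.of_le (by norm_num)) (t, q.2) ht).deriv
  rw [hev.deriv_eq]
  exact (key _ h1 q hq).deriv

/-- The one-directional Green integrand. -/
noncomputable def FF (v u : ℝ → ℝ → ℝ) (q : ℝ × ℝ) : ℝ :=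
  iteratedDeriv 2 (fun x' => v x' q.2) q.1 * u q.1 q.2
    - v q.1 q.2 * iteratedDeriv 2 (fun x' => u x' q.2) q.1

lemma cont_FF {v u : ℝ → ℝ → ℝ} {U : Set (ℝ × ℝ)} (hU : IsOpen U)
    (hv : ContDiffOn ℝ 2 (fun q : ℝ × ℝ => v q.1 q.2) U)
    (hu : ContDiff ℝ 2 (fun q : ℝ × ℝ => u q.1 q.2)) : ContinuousOn (FF v u) U :=
  ((cont_xx hU hv).mul hu.continuous.continuousOn).sub
    (hv.continuousOn.mul (cont_xx hU hu.contDiffOn))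

lemma int_rect {F : ℝ × ℝ → ℝ} {a b c d : ℝ}
    (hF : ContinuousOn F (Set.Icc a b ×ˢ Set.Icc c d)) :
    MeasureTheory.IntegrableOn F (Set.Ioc a b ×ˢ Set.Ioc c d) :=
  (hF.integrableOn_compact (isCompact_Icc.prod isCompact_Icc)).mono_set
    (Set.prod_mono Set.Ioc_subset_Icc_self Set.Ioc_subset_Icc_self)

lemma rect_eq {F : ℝ × ℝ → ℝ} {a b c d : ℝ} (hab : a ≤ b) (hcd : c ≤ d)
    (hF : ContinuousOn F (Set.Icc a b ×ˢ Set.Icc c d)) :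
    ∫ q in Set.Ioc a b ×ˢ Set.Ioc c d, F q = ∫ x in a..b, ∫ y in c..d, F (x, y) := by
  rw [MeasureTheory.Measure.volume_eq_prod, MeasureTheory.setIntegral_prod _ (int_rect hF)]
  simp_rw [intervalIntegral.integral_of_le hab, intervalIntegral.integral_of_le hcd]

lemma rect_eq' {F : ℝ × ℝ → ℝ} {a b c d : ℝ} (hab : a ≤ b) (hcd : c ≤ d)
    (hF : ContinuousOn F (Set.Icc a b ×ˢ Set.Icc c d)) :
    ∫ q in Set.Ioc a b ×ˢ Set.Ioc c d, F q = ∫ y in c..d, ∫ x in a..b, F (x, y) := by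
  rw [rect_eq hab hcd hF]
  apply MeasureTheory.intervalIntegral_intervalIntegral_swap (F := fun x y => F (x, y))
  rw [Set.uIoc_of_le hab, Set.uIoc_of_le hcd]
  exact int_rect hF

lemma strip {v u₁ u₂ : ℝ → ℝ → ℝ} {U : Set (ℝ × ℝ)} (hU : IsOpen U) {a b c d e : ℝ}
    (hab : a ≤ b) (hbc : b ≤ c) (hde : d ≤ e)
    (hsub : Set.Icc a c ×ˢ Set.Icc d e ⊆ U)
    (hv : ContDiffOn ℝ 2 (fun q : ℝ × ℝ => v q.1 q.2) U)
    (h₁ : ContDiff ℝ 2 (fun q : ℝ × ℝ => u₁ q.1 q.2))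
    (h₂ : ContDiff ℝ 2 (fun q : ℝ × ℝ => u₂ q.1 q.2))
    (hvp : ∀ y ∈ Set.Icc d e, v c y = v b y ∧ v a y = v b y)
    (hz₁ : ∀ y ∈ Set.Icc d e, u₁ a y = 0) (hz₂ : ∀ y ∈ Set.Icc d e, u₂ c y = 0)
    (hm : ∀ y ∈ Set.Icc d e, u₁ b y = u₂ b y)
    (hj : ∀ y ∈ Set.Icc d e, deriv (fun x' => u₁ x' y) a - deriv (fun x' => u₁ x' y) b
        + deriv (fun x' => u₂ x' y) b - deriv (fun x' => u₂ x' y) c = 0) :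
    (∫ q in Set.Ioc a b ×ˢ Set.Ioc d e, FF v u₁ q)
      + (∫ q in Set.Ioc b c ×ˢ Set.Ioc d e, FF v u₂ q) = 0 := by
  have s1 : Set.Icc a b ×ˢ Set.Icc d e ⊆ U :=
    (Set.prod_mono (Set.Icc_subset_Icc_right hbc) le_rfl).trans hsub
  have s2 : Set.Icc b c ×ˢ Set.Icc d e ⊆ U :=
    (Set.prod_mono (Set.Icc_subset_Icc_left hab) le_rfl).trans hsub
  have c1 := (cont_FF hU hv h₁).mono s1
  have c2 := (cont_FF hU hv h₂).mono s2
  have G : ∀ (y : ℝ), y ∈ Set.Icc d e → ∀ (u : ℝ → ℝ → ℝ) (a b : ℝ), a ≤ b →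
      ContDiff ℝ 2 (fun q : ℝ × ℝ => u q.1 q.2) → Set.Icc a b ×ˢ Set.Icc d e ⊆ U →
      ∫ x in a..b, FF v u (x, y) =
        (deriv (fun x' => v x' y) b * u b y - v b y * deriv (fun x' => u x' y) b)
        - (deriv (fun x' => v x' y) a * u a y - v a y * deriv (fun x' => u x' y) a) := by
    intro y hy u a b hab hu hs
    have hl : ContDiff ℝ 2 (fun t : ℝ => (t, y)) := contDiff_id.prodMk contDiff_const
    exact green_one (p := fun x' => v x' y) (f := fun x' => u x' y) hab
      (V := (fun t : ℝ => (t, y)) ⁻¹' U) (hU.preimage hl.continuous)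
      (fun t ht => hs ⟨ht, hy⟩) (hv.comp hl.contDiffOn (fun t ht => ht)) (hu.comp hl)
  rw [rect_eq' hab hde c1, rect_eq' hbc hde c2]
  rw [show (∫ y in d..e, ∫ x in b..c, FF v u₂ (x, y))
      = ∫ y in d..e, -∫ x in a..b, FF v u₁ (x, y) from ?_]
  · rw [intervalIntegral.integral_neg]; ring
  apply intervalIntegral.integral_congr
  intro y hy
  rw [Set.uIcc_of_le hde] at hy
  simp only
  rw [G y hy u₁ a b hab h₁ s1, G y hy u₂ b c hbc h₂ s2, hz₁ y hy, hz₂ y hy, hm y hy,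
    (hvp y hy).1, (hvp y hy).2]
  linear_combination v b y * hj y hy

lemma strip' {v u₁ u₂ : ℝ → ℝ → ℝ} {U : Set (ℝ × ℝ)} (hU : IsOpen U) {a b c d e : ℝ}
    (hab : a ≤ b) (hbc : b ≤ c) (hde : d ≤ e)
    (hsub : Set.Icc d e ×ˢ Set.Icc a c ⊆ U)
    (hv : ContDiffOn ℝ 2 (fun q : ℝ × ℝ => v q.1 q.2) U)
    (h₁ : ContDiff ℝ 2 (fun q : ℝ × ℝ => u₁ q.1 q.2))
    (h₂ : ContDiff ℝ 2 (fun q : ℝ × ℝ => u₂ q.1 q.2))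
    (hvp : ∀ y ∈ Set.Icc d e, v y c = v y b ∧ v y a = v y b)
    (hz₁ : ∀ y ∈ Set.Icc d e, u₁ y a = 0) (hz₂ : ∀ y ∈ Set.Icc d e, u₂ y c = 0)
    (hm : ∀ y ∈ Set.Icc d e, u₁ y b = u₂ y b)
    (hj : ∀ y ∈ Set.Icc d e, deriv (fun x' => u₁ y x') a - deriv (fun x' => u₁ y x') b
        + deriv (fun x' => u₂ y x') b - deriv (fun x' => u₂ y x') c = 0) :
    (∫ q in Set.Ioc d e ×ˢ Set.Ioc a b, FF (fun x y => v y x) (fun x y => u₁ y x) q.swap)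
      + (∫ q in Set.Ioc d e ×ˢ Set.Ioc b c,
          FF (fun x y => v y x) (fun x y => u₂ y x) q.swap) = 0 := by
  have hs : ContDiff ℝ 2 (Prod.swap : ℝ × ℝ → ℝ × ℝ) := contDiff_snd.prodMk contDiff_fst
  have := strip (v := fun x y => v y x) (u₁ := fun x y => u₁ y x) (u₂ := fun x y => u₂ y x)
    (hU.preimage hs.continuous) hab hbc hde (fun q hq => hsub ⟨hq.2, hq.1⟩)
    (hv.comp hs.contDiffOn (fun q hq => hq)) (h₁.comp hs) (h₂.comp hs) hvp hz₁ hz₂ hm hj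
  rw [MeasureTheory.Measure.volume_eq_prod] at this ⊢
  rw [MeasureTheory.setIntegral_prod_swap, MeasureTheory.setIntegral_prod_swap]
  exact this

lemma split_piece {v u w : ℝ → ℝ → ℝ} {U : Set (ℝ × ℝ)} (hU : IsOpen U) {a b c d : ℝ}
    (hsub : Set.Icc a b ×ˢ Set.Icc c d ⊆ U)
    (hv : ContDiffOn ℝ 2 (fun q : ℝ × ℝ => v q.1 q.2) U)
    (hu : ContDiff ℝ 2 (fun q : ℝ × ℝ => u q.1 q.2))
    (harm : ∀ x y : ℝ,
        iteratedDeriv 2 (fun x' => u x' y) x + iteratedDeriv 2 (fun y' => u x y') y = 0)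
    (hag : ∀ x ∈ Set.Icc a b, ∀ y ∈ Set.Icc c d, u x y = w x y) :
    ∫ q in Set.Ioc a b ×ˢ Set.Ioc c d,
      (iteratedDeriv 2 (fun x' => v x' q.2) q.1 + iteratedDeriv 2 (fun y' => v q.1 y') q.2)
        * w q.1 q.2
    = (∫ q in Set.Ioc a b ×ˢ Set.Ioc c d, FF v u q)
      + ∫ q in Set.Ioc a b ×ˢ Set.Ioc c d,
          FF (fun x y => v y x) (fun x y => u y x) q.swap := by
  have hs : ContDiff ℝ 2 (Prod.swap : ℝ × ℝ → ℝ × ℝ) := contDiff_snd.prodMk contDiff_fst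
  have c1 := (cont_FF hU hv hu).mono hsub
  have c2 : ContinuousOn (FF (fun x y => v y x) (fun x y => u y x)) (Prod.swap ⁻¹' U) :=
    cont_FF (v := fun x y => v y x) (u := fun x y => u y x) (hU.preimage hs.continuous)
      (hv.comp hs.contDiffOn (fun q hq => hq)) (hu.comp hs)
  have c3 : ContinuousOn (fun q : ℝ × ℝ => FF (fun x y => v y x) (fun x y => u y x) q.swap)
      (Set.Icc a b ×ˢ Set.Icc c d) :=
    c2.comp hs.continuous.continuousOn (fun q hq => by simpa using hsub hq)
  rw [← MeasureTheory.integral_add (int_rect c1) (int_rect c3)]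
  apply MeasureTheory.setIntegral_congr_fun (measurableSet_Ioc.prod measurableSet_Ioc)
  rintro ⟨x, y⟩ ⟨hx, hy⟩
  simp only [FF, Prod.fst_swap, Prod.snd_swap]
  rw [← hag x (Set.Ioc_subset_Icc_self hx) y (Set.Ioc_subset_Icc_self hy)]
  linear_combination v x y * harm x y


theorem adjoint_null_space_solvability (h X Y : ℝ) (hh : 0 < h)
    (w wA wB wC wD : ℝ → ℝ → ℝ)
    -- w is continuous on the element E
    (hwcont : ContinuousOn (fun q : ℝ × ℝ => w q.1 q.2)
        (Set.Icc (X - h) (X + h) ×ˢ Set.Icc (Y - h) (Y + h)))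
    -- w vanishes on the boundary of E
    (hwbdy : ∀ x y : ℝ, (x, y) ∈ Set.Icc (X - h) (X + h) ×ˢ Set.Icc (Y - h) (Y + h) →
        (x = X - h ∨ x = X + h ∨ y = Y - h ∨ y = Y + h) → w x y = 0)
    -- the four pieces are twice continuously differentiable and harmonic
    (hA : ContDiff ℝ 2 (fun q : ℝ × ℝ => wA q.1 q.2))
    (hB : ContDiff ℝ 2 (fun q : ℝ × ℝ => wB q.1 q.2))
    (hC : ContDiff ℝ 2 (fun q : ℝ × ℝ => wC q.1 q.2))
    (hD : ContDiff ℝ 2 (fun q : ℝ × ℝ => wD q.1 q.2))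
    (hAharm : ∀ x y : ℝ,
        iteratedDeriv 2 (fun x' => wA x' y) x + iteratedDeriv 2 (fun y' => wA x y') y = 0)
    (hBharm : ∀ x y : ℝ,
        iteratedDeriv 2 (fun x' => wB x' y) x + iteratedDeriv 2 (fun y' => wB x y') y = 0)
    (hCharm : ∀ x y : ℝ,
        iteratedDeriv 2 (fun x' => wC x' y) x + iteratedDeriv 2 (fun y' => wC x y') y = 0)
    (hDharm : ∀ x y : ℝ,
        iteratedDeriv 2 (fun x' => wD x' y) x + iteratedDeriv 2 (fun y' => wD x y') y = 0)
    -- the pieces agree with w on the four closed subrectangles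
    (hAagree : ∀ x ∈ Set.Icc (X - h) X, ∀ y ∈ Set.Icc (Y - h) Y, wA x y = w x y)
    (hBagree : ∀ x ∈ Set.Icc X (X + h), ∀ y ∈ Set.Icc (Y - h) Y, wB x y = w x y)
    (hCagree : ∀ x ∈ Set.Icc (X - h) X, ∀ y ∈ Set.Icc Y (Y + h), wC x y = w x y)
    (hDagree : ∀ x ∈ Set.Icc X (X + h), ∀ y ∈ Set.Icc Y (Y + h), wD x y = w x y)
    -- the adjoint jump conditions across the internal lines
    (hjump1 : ∀ y ∈ Set.Icc (Y - h) Y,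
        deriv (fun x' => wA x' y) (X - h) - deriv (fun x' => wA x' y) X
        + deriv (fun x' => wB x' y) X - deriv (fun x' => wB x' y) (X + h) = 0)
    (hjump2 : ∀ y ∈ Set.Icc Y (Y + h),
        deriv (fun x' => wC x' y) (X - h) - deriv (fun x' => wC x' y) X
        + deriv (fun x' => wD x' y) X - deriv (fun x' => wD x' y) (X + h) = 0)
    (hjump3 : ∀ x ∈ Set.Icc (X - h) X,
        deriv (fun y' => wA x y') (Y - h) - deriv (fun y' => wA x y') Y
        + deriv (fun y' => wC x y') Y - deriv (fun y' => wC x y') (Y + h) = 0)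
    (hjump4 : ∀ x ∈ Set.Icc X (X + h),
        deriv (fun y' => wB x y') (Y - h) - deriv (fun y' => wB x y') Y
        + deriv (fun y' => wD x y') Y - deriv (fun y' => wD x y') (Y + h) = 0) :
    ∀ v : ℝ → ℝ → ℝ,
      (∃ U : Set (ℝ × ℝ), IsOpen U ∧
          (Set.Icc (X - h) (X + h) ×ˢ Set.Icc (Y - h) (Y + h)) ⊆ U ∧
          ContDiffOn ℝ 2 (fun q : ℝ × ℝ => v q.1 q.2) U) →
      (∀ y ∈ Set.Icc (Y - h) (Y + h), v (X + h) y = v X y ∧ v (X - h) y = v X y) →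
      (∀ x ∈ Set.Icc (X - h) (X + h), v x (Y + h) = v x Y ∧ v x (Y - h) = v x Y) →
      (∫ x in (X - h)..(X + h), ∫ y in (Y - h)..(Y + h),
          (iteratedDeriv 2 (fun x' => v x' y) x + iteratedDeriv 2 (fun y' => v x y') y)
            * w x y) = 0 := by

  rintro v ⟨U, hU, hsub, hv⟩ hvx hvy
  have hs : ContDiff ℝ 2 (Prod.swap : ℝ × ℝ → ℝ × ℝ) := contDiff_snd.prodMk contDiff_fst
  have x1 : X - h ≤ X := by linarith
  have x2 : X ≤ X + h := by linarith
  have y1 : Y - h ≤ Y := by linarith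
  have y2 : Y ≤ Y + h := by linarith
  have ix1 : Set.Icc (X - h) X ⊆ Set.Icc (X - h) (X + h) := Set.Icc_subset_Icc_right x2
  have ix2 : Set.Icc X (X + h) ⊆ Set.Icc (X - h) (X + h) := Set.Icc_subset_Icc_left x1
  have iy1 : Set.Icc (Y - h) Y ⊆ Set.Icc (Y - h) (Y + h) := Set.Icc_subset_Icc_right y2
  have iy2 : Set.Icc Y (Y + h) ⊆ Set.Icc (Y - h) (Y + h) := Set.Icc_subset_Icc_left y1
  set H : ℝ × ℝ → ℝ := fun q =>
    (iteratedDeriv 2 (fun x' => v x' q.2) q.1 + iteratedDeriv 2 (fun y' => v q.1 y') q.2)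
        * w q.1 q.2 with hH
  have cyy : ContinuousOn (fun q : ℝ × ℝ => iteratedDeriv 2 (fun y' => v q.1 y') q.2) U := by
    have := cont_xx (v := fun x y => v y x) (hU.preimage hs.continuous)
      (hv.comp hs.contDiffOn (fun q hq => hq))
    have h2 := this.comp (s := U) (f := Prod.swap) hs.continuous.continuousOn
      (fun q hq => by simpa using hq)
    refine h2.congr (fun q _ => ?_)
    simp only [Function.comp, Prod.fst_swap, Prod.snd_swap]
  have cH : ContinuousOn H (Set.Icc (X - h) (X + h) ×ˢ Set.Icc (Y - h) (Y + h)) :=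
    (((cont_xx hU hv).add cyy).mono hsub).mul hwcont
  have e0 := rect_eq (by linarith) (by linarith) cH
  show (∫ x in (X - h)..(X + h), ∫ y in (Y - h)..(Y + h), H (x, y)) = 0
  rw [← e0]
  have iH := int_rect cH
  have jx : Set.Ioc (X - h) X ∪ Set.Ioc X (X + h) = Set.Ioc (X - h) (X + h) :=
    Set.Ioc_union_Ioc_eq_Ioc x1 x2
  have jy : Set.Ioc (Y - h) Y ∪ Set.Ioc Y (Y + h) = Set.Ioc (Y - h) (Y + h) :=
    Set.Ioc_union_Ioc_eq_Ioc y1 y2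
  have dx : Disjoint (Set.Ioc (X - h) X) (Set.Ioc X (X + h)) := Set.Ioc_disjoint_Ioc_of_le le_rfl
  have dy : Disjoint (Set.Ioc (Y - h) Y) (Set.Ioc Y (Y + h)) := Set.Ioc_disjoint_Ioc_of_le le_rfl
  have sp : ∫ q in Set.Ioc (X - h) (X + h) ×ˢ Set.Ioc (Y - h) (Y + h), H q
      = ((∫ q in Set.Ioc (X - h) X ×ˢ Set.Ioc (Y - h) Y, H q)
        + ∫ q in Set.Ioc (X - h) X ×ˢ Set.Ioc Y (Y + h), H q)
      + ((∫ q in Set.Ioc X (X + h) ×ˢ Set.Ioc (Y - h) Y, H q)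
        + ∫ q in Set.Ioc X (X + h) ×ˢ Set.Ioc Y (Y + h), H q) := by
    rw [← jx, ← jy, Set.union_prod] at iH ⊢
    have iL := iH.left_of_union
    have iR := iH.right_of_union
    rw [MeasureTheory.setIntegral_union (Set.disjoint_prod.2 (Or.inl dx))
      (measurableSet_Ioc.prod (measurableSet_Ioc.union measurableSet_Ioc)) iL iR]
    rw [Set.prod_union] at iL iR
    rw [Set.prod_union, Set.prod_union]
    rw [MeasureTheory.setIntegral_union (Set.disjoint_prod.2 (Or.inr dy))
      (measurableSet_Ioc.prod measurableSet_Ioc) iL.left_of_union iL.right_of_union,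
      MeasureTheory.setIntegral_union (Set.disjoint_prod.2 (Or.inr dy))
      (measurableSet_Ioc.prod measurableSet_Ioc) iR.left_of_union iR.right_of_union]
  have sA := (Set.prod_mono ix1 iy1).trans hsub
  have sB := (Set.prod_mono ix2 iy1).trans hsub
  have sC := (Set.prod_mono ix1 iy2).trans hsub
  have sD := (Set.prod_mono ix2 iy2).trans hsub
  have xl : X - h ∈ Set.Icc (X - h) X := Set.left_mem_Icc.2 x1
  have xm : X ∈ Set.Icc (X - h) X := Set.right_mem_Icc.2 x1
  have xm' : X ∈ Set.Icc X (X + h) := Set.left_mem_Icc.2 x2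
  have xr : X + h ∈ Set.Icc X (X + h) := Set.right_mem_Icc.2 x2
  have yl : Y - h ∈ Set.Icc (Y - h) Y := Set.left_mem_Icc.2 y1
  have ym : Y ∈ Set.Icc (Y - h) Y := Set.right_mem_Icc.2 y1
  have ym' : Y ∈ Set.Icc Y (Y + h) := Set.left_mem_Icc.2 y2
  have yr : Y + h ∈ Set.Icc Y (Y + h) := Set.right_mem_Icc.2 y2
  have t1 := strip hU x1 x2 y1 ((Set.prod_mono le_rfl iy1).trans hsub) hv hA hB
    (fun y hy => hvx y (iy1 hy))
    (fun y hy => by rw [hAagree _ xl y hy]; exact hwbdy _ _ ⟨ix1 xl, iy1 hy⟩ (by simp))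
    (fun y hy => by rw [hBagree _ xr y hy]; exact hwbdy _ _ ⟨ix2 xr, iy1 hy⟩ (by simp))
    (fun y hy => by rw [hAagree _ xm y hy, hBagree _ xm' y hy]) hjump1
  have t2 := strip hU x1 x2 y2 ((Set.prod_mono le_rfl iy2).trans hsub) hv hC hD
    (fun y hy => hvx y (iy2 hy))
    (fun y hy => by rw [hCagree _ xl y hy]; exact hwbdy _ _ ⟨ix1 xl, iy2 hy⟩ (by simp))
    (fun y hy => by rw [hDagree _ xr y hy]; exact hwbdy _ _ ⟨ix2 xr, iy2 hy⟩ (by simp))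
    (fun y hy => by rw [hCagree _ xm y hy, hDagree _ xm' y hy]) hjump2
  have t3 := strip' hU y1 y2 x1 ((Set.prod_mono ix1 le_rfl).trans hsub) hv hA hC
    (fun x hx => hvy x (ix1 hx))
    (fun x hx => by rw [hAagree x hx _ yl]; exact hwbdy _ _ ⟨ix1 hx, iy1 yl⟩ (by simp))
    (fun x hx => by rw [hCagree x hx _ yr]; exact hwbdy _ _ ⟨ix1 hx, iy2 yr⟩ (by simp))
    (fun x hx => by rw [hAagree x hx _ ym, hCagree x hx _ ym']) hjump3
  have t4 := strip' hU y1 y2 x2 ((Set.prod_mono ix2 le_rfl).trans hsub) hv hB hD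
    (fun x hx => hvy x (ix2 hx))
    (fun x hx => by rw [hBagree x hx _ yl]; exact hwbdy _ _ ⟨ix2 hx, iy1 yl⟩ (by simp))
    (fun x hx => by rw [hDagree x hx _ yr]; exact hwbdy _ _ ⟨ix2 hx, iy2 yr⟩ (by simp))
    (fun x hx => by rw [hBagree x hx _ ym, hDagree x hx _ ym']) hjump4
  rw [sp, hH, split_piece hU sA hv hA hAharm hAagree, split_piece hU sB hv hB hBharm hBagree,
    split_piece hU sC hv hC hCharm hCagree, split_piece hU sD hv hD hDharm hDagree]
  linarith
end
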